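/- There is no binary linear code C ⊆ 𝔽₂⁵ of dimension 3 such that every codeword of C has even Hamming weight and every nonzero element of the dual code C^⊥ has Hamming weight ≥ 3. Consequently, no [[10,1,3]] 5-CE CSS code can be obtained from a [[5,1]] CSS code via dual-rail concatenation, since such a construction would require exactly such a [5,3] even-weight code with a [5,2,3] dual. -/

import Mathlib

/-- The dual code of `C`: all vectors orthogonal to every codeword of `C` with
respect to the standard bilinear form over `𝔽₂`. -/
def dualCode {m : ℕ} (C : Submodule (ZMod 2) (Fin m → ZMod 2)) :
    Set (Fin m → ZMod 2) :=
  {x | ∀ c ∈ C, ∑ i, x i * c i = 0}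

/-- There is no binary linear `[5,3]` code all of whose
codewords have even Hamming weight and whose dual code has minimum distance
`≥ 3`; consequently no `[[10,1,3]]` `5`-CE CSS code arises from a `[[5,1]]` CSS
code via dual-rail concatenation. -/
theorem no_even_weight_5_3_code_with_distance_3_dual :
    ¬ ∃ C : Submodule (ZMod 2) (Fin 5 → ZMod 2),
        Module.finrank (ZMod 2) C = 3
        ∧ (∀ c ∈ C, Even (hammingNorm c))
        ∧ (∀ x ∈ dualCode C, x ≠ 0 → 3 ≤ hammingNorm x) := by
  rintro ⟨C, hC, he, hd⟩
  let f : (Fin 5 → ZMod 2) →ₗ[ZMod 2] Module.Dual (ZMod 2) C :=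
    (dotProductBilin (ZMod 2) (ZMod 2)).compl₂ C.subtype
  have hf : ∀ x ∈ LinearMap.ker f, x ∈ dualCode C := by
    intro x hx c hc
    have := LinearMap.congr_fun (LinearMap.mem_ker.1 hx) ⟨c, hc⟩
    simpa [f, dotProduct] using this
  have h1 := LinearMap.finrank_range_add_finrank_ker f
  have h2 := Submodule.finrank_le (LinearMap.range f)
  rw [Subspace.dual_finrank_eq, hC] at h2
  rw [Module.finrank_fin_fun] at h1
  have hn : ¬ LinearMap.ker f ≤ Submodule.span (ZMod 2) {(1 : Fin 5 → ZMod 2)} := by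
    intro hle
    have h3 := Submodule.finrank_mono hle
    have h4 := finrank_span_le_card (R := ZMod 2) ({(1 : Fin 5 → ZMod 2)} : Set (Fin 5 → ZMod 2))
    simp only [Set.toFinset_singleton, Finset.card_singleton] at h4
    omega
  obtain ⟨x, hx, hxs⟩ := SetLike.not_le_iff_exists.1 hn
  have hx0 : x ≠ 0 := by
    rintro rfl
    exact hxs (Submodule.zero_mem _)
  have hx1 : x ≠ 1 := by
    rintro rfl
    exact hxs (Submodule.mem_span_singleton_self _)
  have hxd := hf x hx
  have key : ∀ c : Fin 5 → ZMod 2, Even (hammingNorm c) → ∑ i, c i = 0 := by decide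
  have hx1d : x + 1 ∈ dualCode C := by
    intro c hc
    have e1 := hxd c hc
    have e2 := key c (he c hc)
    simp only [Pi.add_apply, Pi.one_apply, add_mul, one_mul, Finset.sum_add_distrib, e1, e2,
      add_zero]
  have fin : ∀ x : Fin 5 → ZMod 2, x ≠ 0 → x ≠ 1 → 3 ≤ hammingNorm x →
      x + 1 ≠ 0 ∧ ¬ 3 ≤ hammingNorm (x + 1) := by decide
  obtain ⟨a, b⟩ := fin x hx0 hx1 (hd x hxd hx0)
  exact b (hd _ hx1d a)
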